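/- Let r'_n denote the number of non-nesting 231-avoiding permutations of {1,1,...,n,n} whose first entry is 1 and whose last entry is n, and let q_n denote the number of non-nesting 231-avoiding permutations of {1,1,...,n,n} whose first entry is 1. Then r'_1 = 1 and for all n ≥ 2, r'_n = q_{n-1} + r'_{n-1}. -/

import Mathlib

/-- A permutation of the multiset {1,1,2,2,...,n,n}, encoded as a function
`Fin (2*n) → Fin n` where the value `v : Fin n` represents `v+1`:
every value appears exactly twice. -/
def IsMultisetPerm {n : ℕ} (π : Fin (2*n) → Fin n) : Prop :=
  ∀ v : Fin n, (Finset.univ.filter fun i => π i = v).card = 2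

/-- Non-nesting: no indices i<j<k<l with π_i=π_l, π_j=π_k, π_i≠π_j. -/
def NonNesting {n : ℕ} (π : Fin (2*n) → Fin n) : Prop :=
  ¬ ∃ i j k l : Fin (2*n), i < j ∧ j < k ∧ k < l ∧
      π i = π l ∧ π j = π k ∧ π i ≠ π j

/-- Non-crossing: no indices i<j<k<l with π_i=π_k, π_j=π_l, π_i≠π_j. -/
def NonCrossing {n : ℕ} (π : Fin (2*n) → Fin n) : Prop :=
  ¬ ∃ i j k l : Fin (2*n), i < j ∧ j < k ∧ k < l ∧
      π i = π k ∧ π j = π l ∧ π i ≠ π j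

/-- Avoiding the pattern 231: no i<j<k with π_k < π_i < π_j. -/
def Avoids231 {n : ℕ} (π : Fin (2*n) → Fin n) : Prop :=
  ¬ ∃ i j k : Fin (2*n), i < j ∧ j < k ∧ π k < π i ∧ π i < π j

/-- Avoiding 122: no i<j<k with π_i < π_j = π_k. -/
def Avoids122 {n : ℕ} (π : Fin (2*n) → Fin n) : Prop :=
  ¬ ∃ i j k : Fin (2*n), i < j ∧ j < k ∧ π i < π j ∧ π j = π k

/-- The first entry is the value 1 (encoded as `0 : Fin n`). -/
def FirstIsOne {n : ℕ} (π : Fin (2*n) → Fin n) : Prop :=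
  ∃ h : 0 < n, π ⟨0, by omega⟩ = ⟨0, h⟩

/-- The last entry is the value n (encoded as `n-1 : Fin n`). -/
def LastIsMax {n : ℕ} (π : Fin (2*n) → Fin n) : Prop :=
  ∃ h : 0 < n, π ⟨2*n - 1, by omega⟩ = ⟨n - 1, by omega⟩

/-- Non-nesting 231-avoiding permutations with first entry 1. -/
noncomputable def qNN (n : ℕ) : ℕ :=
  Nat.card {π : Fin (2*n) → Fin n //
    IsMultisetPerm π ∧ NonNesting π ∧ Avoids231 π ∧ FirstIsOne π}

/-- Non-nesting 231-avoiding permutations with first entry 1 and last entry n. -/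
noncomputable def rNN' (n : ℕ) : ℕ :=
  Nat.card {π : Fin (2*n) → Fin n //
    IsMultisetPerm π ∧ NonNesting π ∧ Avoids231 π ∧ FirstIsOne π ∧ LastIsMax π}

theorem mp_iff {n : ℕ} (π : Fin (2*n) → Fin n) : IsMultisetPerm π ↔
    ∀ v, ∃ a b, a < b ∧ π a = v ∧ π b = v ∧ ∀ c, π c = v → c = a ∨ c = b := by
  unfold IsMultisetPerm
  refine forall_congr' fun v => ?_
  rw [Finset.card_eq_two]
  constructor
  · rintro ⟨x, y, hxy, h⟩
    have h' : ∀ c, π c = v ↔ c = x ∨ c = y := by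
      intro c
      have := congrArg (fun s => c ∈ s) h
      simpa using this
    rcases lt_or_gt_of_ne hxy with hl | hl
    · exact ⟨x, y, hl, (h' x).2 (Or.inl rfl), (h' y).2 (Or.inr rfl), fun c hc => (h' c).1 hc⟩
    · exact ⟨y, x, hl, (h' y).2 (Or.inr rfl), (h' x).2 (Or.inl rfl), fun c hc => ((h' c).1 hc).symm⟩
  · rintro ⟨a, b, hab, ha, hb, h⟩
    refine ⟨a, b, hab.ne, ?_⟩
    ext c
    simp only [Finset.mem_filter, Finset.mem_univ, true_and, Finset.mem_insert,
      Finset.mem_singleton]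
    constructor
    · exact h c
    · rintro (rfl | rfl) <;> assumption

/-- Order embedding of old positions, skipping position `p` (and the last one). -/
def skipPos (m p : ℕ) (i : Fin (2*m)) : Fin (2*(m+1)) :=
  if i.1 < p then ⟨i.1, by omega⟩ else ⟨i.1 + 1, by omega⟩

theorem skipPos_val (m p : ℕ) (i : Fin (2*m)) :
    (skipPos m p i).1 = if i.1 < p then i.1 else i.1 + 1 := by
  unfold skipPos; split <;> rfl

theorem skipPos_lt (m p : ℕ) (i j : Fin (2*m)) : skipPos m p i < skipPos m p j ↔ i < j := by
  rw [Fin.lt_def, Fin.lt_def, skipPos_val, skipPos_val]; split_ifs <;> omega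

theorem skipPos_inj (m p : ℕ) (i j : Fin (2*m)) : skipPos m p i = skipPos m p j ↔ i = j := by
  rw [Fin.ext_iff, Fin.ext_iff, skipPos_val, skipPos_val]; split_ifs <;> omega

theorem skipPos_cases (m p : ℕ) (hp : p ≤ 2*m) (j : Fin (2*(m+1))) :
    j.1 = p ∨ j.1 = 2*m+1 ∨ ∃ i, j = skipPos m p i := by
  by_cases h1 : j.1 = p
  · exact Or.inl h1
  by_cases h2 : j.1 = 2*m+1
  · exact Or.inr (Or.inl h2)
  refine Or.inr (Or.inr ?_)
  have := j.2
  by_cases h : j.1 < p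
  · exact ⟨⟨j.1, by omega⟩, by rw [Fin.ext_iff, skipPos_val]; simp [h]⟩
  · refine ⟨⟨j.1 - 1, by omega⟩, ?_⟩
    rw [Fin.ext_iff, skipPos_val]; split_ifs with h3 <;> simp at * <;> omega

/-- `π` arises from `σ` by inserting the new maximum at `p` and at the end. -/
structure InsRel {m : ℕ} (p : ℕ) (π : Fin (2*(m+1)) → Fin (m+1)) (σ : Fin (2*m) → Fin m) : Prop where
  hp : p ≤ 2*m
  h1 : ∀ i, π (skipPos m p i) = (σ i).castSucc
  h2 : ∀ j, j.1 = p → π j = Fin.last m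
  h3 : ∀ j, j.1 = 2*m+1 → π j = Fin.last m

theorem InsRel.eq_last {m p : ℕ} {π : Fin (2*(m+1)) → Fin (m+1)} {σ : Fin (2*m) → Fin m}
    (R : InsRel p π σ) (j) : π j = Fin.last m ↔ j.1 = p ∨ j.1 = 2*m+1 := by
  constructor
  · intro h
    rcases skipPos_cases m p R.hp j with h' | h' | ⟨i, rfl⟩
    · exact Or.inl h'
    · exact Or.inr h'
    · rw [R.h1] at h; exact absurd h (Fin.castSucc_lt_last _).ne
  · rintro (h | h)
    · exact R.h2 j h
    · exact R.h3 j h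

theorem InsRel.lift {m p : ℕ} {π : Fin (2*(m+1)) → Fin (m+1)} {σ : Fin (2*m) → Fin m}
    (R : InsRel p π σ) (j) (h : π j ≠ Fin.last m) : ∃ i, j = skipPos m p i := by
  rcases skipPos_cases m p R.hp j with h' | h' | h'
  · exact absurd (R.h2 j h') h
  · exact absurd (R.h3 j h') h
  · obtain ⟨i, hi⟩ := h'
    exact ⟨i, hi⟩

/-- Common conditions. -/
def Good {n : ℕ} (π : Fin (2*n) → Fin n) : Prop :=
  IsMultisetPerm π ∧ NonNesting π ∧ Avoids231 π

theorem InsRel.down {m p : ℕ} {π : Fin (2*(m+1)) → Fin (m+1)} {σ : Fin (2*m) → Fin m}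
    (R : InsRel p π σ) (G : Good π) : Good σ := by
  obtain ⟨G1, G2, G3⟩ := G
  refine ⟨?_, ?_, ?_⟩
  · rw [mp_iff] at G1 ⊢
    intro v
    obtain ⟨a, b, hab, ha, hb, hc⟩ := G1 v.castSucc
    obtain ⟨a, rfl⟩ := R.lift a (by rw [ha]; exact (Fin.castSucc_lt_last _).ne)
    obtain ⟨b, rfl⟩ := R.lift b (by rw [hb]; exact (Fin.castSucc_lt_last _).ne)
    rw [R.h1, Fin.castSucc_inj] at ha hb
    refine ⟨a, b, (skipPos_lt _ _ _ _).1 hab, ha, hb, fun c h => ?_⟩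
    have := hc (skipPos m p c) (by rw [R.h1, h])
    simpa only [skipPos_inj] using this
  · rintro ⟨i, j, k, l, h1, h2, h3, h4, h5, h6⟩
    refine G2 ⟨skipPos m p i, skipPos m p j, skipPos m p k, skipPos m p l, ?_⟩
    simp only [skipPos_lt, R.h1, Fin.castSucc_inj, ne_eq]
    exact ⟨h1, h2, h3, h4, h5, h6⟩
  · rintro ⟨i, j, k, h1, h2, h3, h4⟩
    refine G3 ⟨skipPos m p i, skipPos m p j, skipPos m p k, ?_⟩
    simp only [skipPos_lt, R.h1, Fin.castSucc_lt_castSucc_iff]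
    exact ⟨h1, h2, h3, h4⟩

theorem InsRel.up {m p : ℕ} {π : Fin (2*(m+1)) → Fin (m+1)} {σ : Fin (2*m) → Fin m}
    (R : InsRel p π σ) (G : Good σ)
    (hp : p = 2*m ∨ (p + 1 = 2*m ∧ ∀ i : Fin (2*m), i.1 + 1 = 2*m → (σ i).1 + 1 = m)) :
    Good π := by
  obtain ⟨G1, G2, G3⟩ := G
  refine ⟨?_, ?_, ?_⟩
  · rw [mp_iff] at G1 ⊢
    intro v
    induction v using Fin.lastCases with
    | last =>
      have := R.hp
      refine ⟨⟨p, by omega⟩, ⟨2*m+1, by omega⟩, ?_, R.h2 _ rfl, R.h3 _ rfl, ?_⟩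
      · rw [Fin.lt_def]; show p < 2*m+1; omega
      · intro c hc
        rw [Fin.ext_iff, Fin.ext_iff]
        exact (R.eq_last c).1 hc
    | cast v =>
      obtain ⟨a, b, hab, ha, hb, hc⟩ := G1 v
      refine ⟨skipPos m p a, skipPos m p b, (skipPos_lt _ _ _ _).2 hab, by rw [R.h1, ha],
        by rw [R.h1, hb], fun c h => ?_⟩
      obtain ⟨c, rfl⟩ := R.lift c (by rw [h]; exact (Fin.castSucc_lt_last _).ne)
      rw [R.h1, Fin.castSucc_inj] at h
      simpa only [skipPos_inj] using hc c h
  · rintro ⟨i, j, k, l, h1, h2, h3, h4, h5, h6⟩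
    rw [Fin.lt_def] at h1 h2 h3
    have := l.2
    by_cases hi : π i = Fin.last m
    · have e1 := (R.eq_last i).1 hi
      omega
    by_cases hj : π j = Fin.last m
    · have e1 := (R.eq_last j).1 hj
      have e2 := (R.eq_last k).1 (h5 ▸ hj)
      omega
    obtain ⟨i, rfl⟩ := R.lift i hi
    obtain ⟨j, rfl⟩ := R.lift j hj
    obtain ⟨k, rfl⟩ := R.lift k (h5 ▸ hj)
    obtain ⟨l, rfl⟩ := R.lift l (h4 ▸ hi)
    rw [← Fin.lt_def, skipPos_lt] at h1 h2 h3
    simp only [R.h1, Fin.castSucc_inj, ne_eq] at h4 h5 h6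
    exact G2 ⟨i, j, k, l, h1, h2, h3, h4, h5, h6⟩
  · rintro ⟨i, j, k, h1, h2, h3, h4⟩
    have hi : π i ≠ Fin.last m := (h4.trans_le (Fin.le_last _)).ne
    have hk : π k ≠ Fin.last m := (h3.trans_le (Fin.le_last _)).ne
    obtain ⟨i, rfl⟩ := R.lift i hi
    obtain ⟨k, rfl⟩ := R.lift k hk
    by_cases hj : π j = Fin.last m
    · have e1 := (R.eq_last j).1 hj
      rw [R.h1, R.h1, Fin.castSucc_lt_castSucc_iff, Fin.lt_def] at h3
      rw [Fin.lt_def] at h1 h2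
      have e3 := skipPos_val m p k
      have hk2 := k.2
      have hi2 := (σ i).2
      rcases hp with hp | ⟨hp, hs⟩
      · split_ifs at e3 <;> omega
      · have := hs k (by split_ifs at e3 <;> omega)
        omega
    obtain ⟨j, rfl⟩ := R.lift j hj
    rw [skipPos_lt] at h1 h2
    simp only [R.h1, Fin.castSucc_lt_castSucc_iff] at h3 h4
    exact G3 ⟨i, j, k, h1, h2, h3, h4⟩

/-- The insertion. -/
def ins {m : ℕ} (p : ℕ) (σ : Fin (2*m) → Fin m) : Fin (2*(m+1)) → Fin (m+1) := fun j =>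
  if h : j.1 < p ∧ j.1 < 2*m then (σ ⟨j.1, h.2⟩).castSucc
  else if h : p < j.1 ∧ j.1 < 2*m+1 then (σ ⟨j.1 - 1, by omega⟩).castSucc
  else Fin.last m

theorem ins_rel {m p : ℕ} (hp : p ≤ 2*m) (σ : Fin (2*m) → Fin m) : InsRel p (ins p σ) σ := by
  refine ⟨hp, ?_, ?_, ?_⟩
  · intro i
    have hi := i.2
    have e := skipPos_val m p i
    by_cases h : i.1 < p
    · simp only [h, if_true] at e
      unfold ins
      rw [dif_pos (by omega)]
      congr 2
      exact Fin.ext e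
    · simp only [h, if_false] at e
      unfold ins
      rw [dif_neg (by omega), dif_pos (by omega)]
      congr 2
      apply Fin.ext
      show (skipPos m p i).1 - 1 = i.1
      omega
  · intro j hj
    unfold ins
    rw [dif_neg (by omega), dif_neg (by omega)]
  · intro j hj
    unfold ins
    rw [dif_neg (by omega), dif_neg (by omega)]

theorem InsRel.uniq {m p : ℕ} {π π' : Fin (2*(m+1)) → Fin (m+1)} {σ : Fin (2*m) → Fin m}
    (R : InsRel p π σ) (R' : InsRel p π' σ) : π = π' := by
  funext j
  rcases skipPos_cases m p R.hp j with h' | h' | ⟨i, rfl⟩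
  · rw [R.h2 j h', R'.h2 j h']
  · rw [R.h3 j h', R'.h3 j h']
  · rw [R.h1, R'.h1]

theorem InsRel.uniq' {m p : ℕ} {π : Fin (2*(m+1)) → Fin (m+1)} {σ σ' : Fin (2*m) → Fin m}
    (R : InsRel p π σ) (R' : InsRel p π σ') : σ = σ' := by
  funext j
  have := (R.h1 j).symm.trans (R'.h1 j)
  exact Fin.castSucc_inj.1 this

theorem InsRel.first {m p : ℕ} {π : Fin (2*(m+1)) → Fin (m+1)} {σ : Fin (2*m) → Fin m}
    (R : InsRel p π σ) (hm : 1 ≤ m) (hp : 1 ≤ p) : FirstIsOne π ↔ FirstIsOne σ := by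
  have e : (⟨0, by omega⟩ : Fin (2*(m+1))) = skipPos m p ⟨0, by omega⟩ := by
    rw [Fin.ext_iff, skipPos_val, if_pos (by exact hp)]
  have h := R.h1 ⟨0, by omega⟩
  rw [← e] at h
  have h' := congrArg Fin.val h
  rw [Fin.val_castSucc] at h'
  constructor
  · rintro ⟨_, h1⟩; exact ⟨hm, Fin.ext (h'.symm.trans (congrArg Fin.val h1))⟩
  · rintro ⟨_, h1⟩; exact ⟨by omega, Fin.ext (h'.trans (congrArg Fin.val h1))⟩

theorem InsRel.last {m p : ℕ} {π : Fin (2*(m+1)) → Fin (m+1)} {σ : Fin (2*m) → Fin m}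
    (R : InsRel p π σ) : LastIsMax π :=
  ⟨by omega, R.h3 _ (by show 2*(m+1)-1 = _; omega)⟩

theorem exists_rel {m p : ℕ} (hp : p ≤ 2*m) (π : Fin (2*(m+1)) → Fin (m+1))
    (h : ∀ j, π j = Fin.last m ↔ j.1 = p ∨ j.1 = 2*m+1) : ∃ σ : Fin (2*m) → Fin m, InsRel p π σ := by
  have hne : ∀ i, π (skipPos m p i) ≠ Fin.last m := by
    intro i hi
    have := (h _).1 hi
    have e := skipPos_val m p i
    have := i.2
    split_ifs at e <;> omega
  refine ⟨fun i => (π (skipPos m p i)).castPred (hne i), hp, ?_, ?_, ?_⟩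
  · intro i; simp
  · intro j hj; exact (h j).2 (Or.inl hj)
  · intro j hj; exact (h j).2 (Or.inr hj)

/-- Structure of permutations ending with the maximum. -/
theorem ending_lemma {m : ℕ} (hm : 1 ≤ m) (π : Fin (2*(m+1)) → Fin (m+1)) (G : Good π)
    (hf : FirstIsOne π) (hl : LastIsMax π) :
    (∃ σ : Fin (2*m) → Fin m, InsRel (2*m) π σ) ∨
    (∃ σ : Fin (2*m) → Fin m, InsRel (2*m-1) π σ ∧ LastIsMax σ) := by
  obtain ⟨G1, G2, G3⟩ := G
  rw [mp_iff] at G1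
  obtain ⟨_, hl⟩ := hl
  obtain ⟨a, b, hab, ha, hb, hc⟩ := G1 (Fin.last m)
  have hbv : b.1 = 2*m+1 := by
    rw [Fin.lt_def] at hab
    have := b.2
    rcases hc _ hl with h | h <;> rw [Fin.ext_iff] at h <;> simp only at h <;> omega
  have key : ∀ j, π j = Fin.last m ↔ j.1 = a.1 ∨ j.1 = 2*m+1 := by
    intro j
    constructor
    · intro h
      rcases hc j h with rfl | rfl
      · exact Or.inl rfl
      · exact Or.inr hbv
    · rintro (h | h)
      · rw [Fin.ext h, ha]
      · rw [Fin.ext (h.trans hbv.symm), hb]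
  have hab' : a.1 ≤ 2*m := by rw [Fin.lt_def] at hab; omega
  rcases Nat.lt_or_ge a.1 (2*m) with hlt | hge
  swap
  · left
    have : a.1 = 2*m := le_antisymm hab' hge
    refine exists_rel (le_refl _) π fun j => ?_
    rw [key j, this]
  right
  -- every position strictly between has its partner before `a`
  have partner : ∀ d : Fin (2*(m+1)), a < d → d < b → ∃ c, c < a ∧ π c = π d := by
    intro d h1 h2
    have hd : π d ≠ Fin.last m := by
      intro h
      rcases hc d h with rfl | rfl
      · exact lt_irrefl _ h1
      · exact lt_irrefl _ h2
    obtain ⟨x, y, hxy, hx, hy, hxy'⟩ := G1 (π d)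
    have main : ∀ c e, c ≠ e → π c = π e → π c = π d → a < e → e < b → c < a := by
      intro c e hne h3 h4 h5 h6
      by_contra hca
      have hca : a < c := by
        refine lt_of_le_of_ne (not_lt.1 hca) ?_
        rintro rfl
        exact hd (h4 ▸ ha)
      have hcb : c < b := by
        have h7 : c.1 ≠ b.1 := by
          intro h; rw [Fin.ext h] at h4; exact hd (h4 ▸ hb)
        have := c.2
        rw [Fin.lt_def]; omega
      rcases lt_or_gt_of_ne hne with h | h
      · exact G2 ⟨a, c, e, b, hca, h, h6, ha.trans hb.symm, h3, by rw [ha, h4]; exact hd.symm⟩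
      · exact G2 ⟨a, e, c, b, h5, h, hcb, ha.trans hb.symm, h3.symm,
          by rw [ha, ← h3, h4]; exact hd.symm⟩
    rcases hxy' d rfl with rfl | rfl
    · exact ⟨y, main y d hxy.ne' (by rw [hy]) hy h1 h2, hy⟩
    · exact ⟨x, main x d hxy.ne (by rw [hx]) hx h1 h2, hx⟩
  have ltl : ∀ d, π d ≠ Fin.last m → π d < π a := by
    intro d hd; rw [ha]; exact lt_of_le_of_ne (Fin.le_last _) hd
  have nl : ∀ d, a < d → d < b → π d ≠ Fin.last m := by
    intro d h1 h2 h
    rcases hc d h with rfl | rfl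
    · exact lt_irrefl _ h1
    · exact lt_irrefl _ h2
  have le : ∀ d e, a < d → d < b → a < e → e < b → π d ≤ π e := by
    intro d e h1 h2 h3 h4
    obtain ⟨c, hca, hcd⟩ := partner d h1 h2
    by_contra h
    exact G3 ⟨c, a, e, hca, h3, by rw [hcd]; exact not_le.1 h, by rw [hcd]; exact ltl d (nl d h1 h2)⟩
  have uniq : ∀ d e, a < d → d < b → a < e → e < b → d = e := by
    intro d e h1 h2 h3 h4
    have heq : π d = π e := le_antisymm (le d e h1 h2 h3 h4) (le e d h3 h4 h1 h2)
    obtain ⟨c, hca, hcd⟩ := partner d h1 h2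
    obtain ⟨x, y, hxy, hx, hy, hxy'⟩ := G1 (π d)
    have u1 := hxy' c hcd
    have u2 := hxy' d rfl
    have u3 := hxy' e heq.symm
    have n1 : c ≠ d := (hca.trans h1).ne
    have n2 : c ≠ e := (hca.trans h3).ne
    grind
  have ha1 : a.1 = 2*m-1 := by
    by_contra hne
    have := uniq ⟨2*m, by omega⟩ ⟨2*m-1, by omega⟩ (by rw [Fin.lt_def]; exact hlt)
      (by rw [Fin.lt_def]; show 2*m < b.1; omega) (by rw [Fin.lt_def]; show a.1 < 2*m-1; omega)
      (by rw [Fin.lt_def]; show 2*m-1 < b.1; omega)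
    rw [Fin.ext_iff] at this
    simp only at this
    omega
  rw [ha1] at key
  obtain ⟨σ, R⟩ := exists_rel (by omega) π key
  refine ⟨σ, R, hm, ?_⟩
  have e : skipPos m (2*m-1) ⟨2*m-1, by omega⟩ = ⟨2*m, by omega⟩ := by
    rw [Fin.ext_iff, skipPos_val, if_neg (by simp)]
    show 2*m-1+1 = 2*m
    omega
  have h1 := R.h1 ⟨2*m-1, by omega⟩
  rw [e] at h1
  by_contra hne
  obtain ⟨x, y, hxy, hx, hy, hxy'⟩ := G1 (Fin.castSucc ⟨m-1, by omega⟩)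
  have hlt2 : π ⟨2*m, by omega⟩ < π x := by
    rw [h1, hx, Fin.castSucc_lt_castSucc_iff]
    refine lt_of_le_of_ne ?_ hne
    rw [Fin.le_def]
    have := (σ ⟨2*m-1, by omega⟩).2
    show (σ ⟨2*m-1, by omega⟩).1 ≤ m-1
    omega
  have hxl : π x ≠ Fin.last m := by rw [hx]; exact (Fin.castSucc_lt_last _).ne
  have hxa : x < a := by
    have q1 : ¬ (x.1 = 2*m-1 ∨ x.1 = 2*m+1) := fun h => hxl ((key x).2 h)
    have q2 : x.1 ≠ 2*m := by
      intro h
      have : x = ⟨2*m, by omega⟩ := Fin.ext h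
      rw [← this] at hlt2
      exact lt_irrefl _ hlt2
    have := x.2
    rw [Fin.lt_def]; omega
  exact G3 ⟨x, a, ⟨2*m, by omega⟩, hxa, by rw [Fin.lt_def]; exact hlt, hlt2, ltl x hxl⟩

theorem step (m : ℕ) (hm : 1 ≤ m) : rNN' (m+1) = qNN m + rNN' m := by
  unfold rNN' qNN
  rw [← Nat.card_sum]
  symm
  have lastσ : ∀ σ : Fin (2*m) → Fin m, LastIsMax σ →
      ∀ i : Fin (2*m), i.1 + 1 = 2*m → (σ i).1 + 1 = m := by
    rintro σ ⟨_, h⟩ i hi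
    have : i = ⟨2*m-1, by omega⟩ := Fin.ext (by show i.1 = 2*m-1; omega)
    rw [this, h]
    show m-1+1 = m
    omega
  let f : ({π : Fin (2*m) → Fin m //
      IsMultisetPerm π ∧ NonNesting π ∧ Avoids231 π ∧ FirstIsOne π} ⊕
      {π : Fin (2*m) → Fin m //
      IsMultisetPerm π ∧ NonNesting π ∧ Avoids231 π ∧ FirstIsOne π ∧ LastIsMax π}) →
      {π : Fin (2*(m+1)) → Fin (m+1) //
      IsMultisetPerm π ∧ NonNesting π ∧ Avoids231 π ∧ FirstIsOne π ∧ LastIsMax π} := fun s =>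
    match s with
    | Sum.inl σ => ⟨ins (2*m) σ.1, by
        obtain ⟨σ, a, b, c, d⟩ := σ
        have R := ins_rel (le_refl _) σ
        obtain ⟨a', b', c'⟩ := R.up ⟨a, b, c⟩ (Or.inl rfl)
        exact ⟨a', b', c', (R.first hm (by omega)).2 d, R.last⟩⟩
    | Sum.inr σ => ⟨ins (2*m-1) σ.1, by
        obtain ⟨σ, a, b, c, d, e⟩ := σ
        have R := ins_rel (p := 2*m-1) (by omega) σ
        obtain ⟨a', b', c'⟩ := R.up ⟨a, b, c⟩ (Or.inr ⟨by omega, lastσ σ e⟩)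
        exact ⟨a', b', c', (R.first hm (by omega)).2 d, R.last⟩⟩
  have ne : ∀ σ σ' : Fin (2*m) → Fin m, ins (2*m) σ ≠ ins (2*m-1) σ' := by
    intro σ σ' h
    have R := ins_rel (p := 2*m) (by omega) σ
    have R' := ins_rel (p := 2*m-1) (by omega) σ'
    have e := (R.eq_last ⟨2*m, by omega⟩).2 (Or.inl rfl)
    rw [h, R'.eq_last] at e
    simp only at e
    omega
  apply Nat.card_congr (Equiv.ofBijective f ⟨?_, ?_⟩)
  · rintro (⟨σ, hσ⟩ | ⟨σ, hσ⟩) (⟨τ, hτ⟩ | ⟨τ, hτ⟩) h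
    · have h' : ins (2*m) σ = ins (2*m) τ := congrArg Subtype.val h
      have R := ins_rel (p := 2*m) (by omega) σ
      have R' := ins_rel (p := 2*m) (by omega) τ
      rw [h'] at R
      have := R.uniq' R'
      subst this
      rfl
    · exact absurd (congrArg Subtype.val h) (ne σ τ)
    · exact absurd (congrArg Subtype.val h).symm (ne τ σ)
    · have h' : ins (2*m-1) σ = ins (2*m-1) τ := congrArg Subtype.val h
      have R := ins_rel (p := 2*m-1) (by omega) σ
      have R' := ins_rel (p := 2*m-1) (by omega) τ
      rw [h'] at R
      have := R.uniq' R'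
      subst this
      rfl
  · rintro ⟨π, a, b, c, d, e⟩
    rcases ending_lemma hm π ⟨a, b, c⟩ d e with ⟨σ, R⟩ | ⟨σ, R, hl⟩
    · obtain ⟨a', b', c'⟩ := R.down ⟨a, b, c⟩
      refine ⟨Sum.inl ⟨σ, a', b', c', (R.first hm (by omega)).1 d⟩, ?_⟩
      apply Subtype.ext
      exact (ins_rel R.hp σ).uniq R
    · obtain ⟨a', b', c'⟩ := R.down ⟨a, b, c⟩
      refine ⟨Sum.inr ⟨σ, a', b', c', (R.first hm (by omega)).1 d, hl⟩, ?_⟩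
      apply Subtype.ext
      exact (ins_rel R.hp σ).uniq R

theorem base : rNN' 1 = 1 := by
  unfold rNN'
  rw [Nat.card_eq_one_iff_unique]
  refine ⟨⟨fun x y => Subtype.ext (funext fun i => Subsingleton.elim _ _)⟩,
    ⟨⟨fun _ => 0, ?_, ?_, ?_, ?_, ?_⟩⟩⟩
  · intro v
    have : v = 0 := Subsingleton.elim _ _
    subst this
    simp
  · rintro ⟨i, j, k, l, h1, h2, h3, h4, h5, h6⟩; exact h6 rfl
  · rintro ⟨i, j, k, h1, h2, h3, h4⟩; exact lt_irrefl _ h3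
  · exact ⟨one_pos, rfl⟩
  · exact ⟨one_pos, rfl⟩

theorem stmt6 : rNN' 1 = 1 ∧ ∀ n, 2 ≤ n → rNN' n = qNN (n-1) + rNN' (n-1) := by
  refine ⟨base, fun n hn => ?_⟩
  obtain ⟨m, rfl⟩ : ∃ m, n = m + 1 := ⟨n - 1, by omega⟩
  exact step m (by omega)
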